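/- arXiv:math/0212147 — 2 statements merged into one kernel-verified Lean document; each statement's English description precedes it below -/
import Mathlib

section
/- The assignment (z;p,q) ↦ (Log z + pπi) ∧ (-Log(1-z) + qπi), where on each sheet of 𝓒 the logarithms are the corresponding analytic continuations of the principal branch, vanishes on every lifted five-term relation and every transfer relation, and hence induces a well-defined group homomorphism ν : êP(ℂ) → ℂ ∧_ℤ ℂ with ν[z,p,q] = (Log z + pπi) ∧ (-Log(1-z) + qπi). -/
open Complex
open scoped Classical

noncomputable section

namespace ExtendedBloch

/-- `π` as a complex number. -/
def Cpi : ℂ := (Real.pi : ℂ)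

/-- Membership in `ℂ ∖ {0,1}`. -/
def Reg (z : ℂ) : Prop := z ≠ 0 ∧ z ≠ 1

/-- The open upper half plane. -/
def UHP : Set ℂ := {z : ℂ | 0 < z.im}

/-- The 5-tuple occurring in the five term relation. -/
def ftTuple (x y : ℂ) : Fin 5 → ℂ :=
  ![x, y, y / x, (1 - x⁻¹) / (1 - y⁻¹), (1 - x) / (1 - y)]

/-- The set `FT` of five term tuples. -/
def FT : Set (Fin 5 → ℂ) :=
  {v | ∃ x y : ℂ, Reg x ∧ Reg y ∧ x ≠ y ∧ v = ftTuple x y}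

/-- The subset `FT⁺` of tuples with all coordinates in the upper half plane. -/
def FTplus : Set (Fin 5 → ℂ) := {v | v ∈ FT ∧ ∀ i, v i ∈ UHP}

/-- The point `(z; p, q)` of the cover `𝓒` of `ℂ ∖ {0,1}`, realized concretely as the pair of
branch values `(log z + pπi, -log(1-z) + qπi)` (Riemann surface model of `𝓒`). -/
def pt (z : ℂ) (p q : ℤ) : ℂ × ℂ :=
  (Complex.log z + p * (Cpi * I), -Complex.log (1 - z) + q * (Cpi * I))

/-- The cover `𝓒`, realized as the Riemann surface of all branches of
`(log z + pπi, -log(1-z) + qπi)` on `ℂ ∖ {0,1}`. -/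
def Cover : Set (ℂ × ℂ) := {w | ∃ z : ℂ, Reg z ∧ ∃ p q : ℤ, w = pt z p q}

lemma pt_mem_Cover {z : ℂ} (h : Reg z) (p q : ℤ) : pt z p q ∈ Cover :=
  ⟨z, h, p, q, rfl⟩

/-- `w ∈ 𝓒` lies over `z ∈ ℂ ∖ {0,1}`. -/
def LiesOver (w : ℂ × ℂ) (z : ℂ) : Prop := Reg z ∧ ∃ p q : ℤ, w = pt z p q

/-- The covering action of `ℤ × ℤ` on `𝓒`. -/
def covAct (v : ℤ × ℤ) (w : ℂ × ℂ) : ℂ × ℂ :=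
  (w.1 + v.1 * (Cpi * I), w.2 + v.2 * (Cpi * I))

/-- The subset `V ⊂ (ℤ × ℤ)⁵`. -/
def Vset : Set (Fin 5 → ℤ × ℤ) :=
  {v | ∃ p₀ p₁ q₀ q₁ q₂ : ℤ,
    v = ![(p₀, q₀), (p₁, q₁), (p₁ - p₀, q₂), (p₁ - p₀ + q₁ - q₀, q₂ - q₁),
          (q₁ - q₀, q₂ - q₁ - p₀)]}

/-- The preimage of `FT` in `𝓒⁵`. -/
def FTpre : Set (Fin 5 → ℂ × ℂ) := {w | ∃ v ∈ FT, ∀ i, LiesOver (w i) (v i)}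

/-- A base point `((x₀;0,0),…,(x₄;0,0))` with `(x₀,…,x₄) ∈ FT⁺`. -/
def basePt : Fin 5 → ℂ × ℂ := fun i => pt (ftTuple ((1 + I) / 4) I i) 0 0

/-- `𝓕𝓣̂₀`: the connected component of the preimage of `FT` in `𝓒⁵` containing the points
`((x₀;0,0),…,(x₄;0,0))` with `(x₀,…,x₄) ∈ FT⁺`. -/
def FThat₀ : Set (Fin 5 → ℂ × ℂ) := connectedComponentIn FTpre basePt

/-- `𝓕𝓣̂ = 𝓕𝓣̂₀ + V`. -/
def FThat : Set (Fin 5 → ℂ × ℂ) :=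
  {u | ∃ w ∈ FThat₀, ∃ v ∈ Vset, u = fun i => covAct (v i) (w i)}

abbrev CoverT : Type := ↥Cover

/-- The generator `(z; p, q)` of the free abelian group on `𝓒`. -/
def genOf (z : ℂ) (h : Reg z) (p q : ℤ) : FreeAbelianGroup CoverT :=
  FreeAbelianGroup.of ⟨pt z p q, pt_mem_Cover h p q⟩

/-- The lifted five term relators. -/
def FiveTermRels : Set (FreeAbelianGroup CoverT) :=
  {a | ∃ w : Fin 5 → ℂ × ℂ, w ∈ FThat ∧ ∃ hc : ∀ i, w i ∈ Cover,
    a = ∑ i : Fin 5, (-1 : ℤ) ^ (i : ℕ) • FreeAbelianGroup.of (⟨w i, hc i⟩ : CoverT)}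

/-- The transfer relators. -/
def TransferRels : Set (FreeAbelianGroup CoverT) :=
  {a | ∃ z : ℂ, ∃ h : Reg z, ∃ p q p' q' : ℤ,
    a = genOf z h p q + genOf z h p' q' - genOf z h p q' - genOf z h p' q}

def relSub : AddSubgroup (FreeAbelianGroup CoverT) :=
  AddSubgroup.closure (FiveTermRels ∪ TransferRels)

def relSub' : AddSubgroup (FreeAbelianGroup CoverT) :=
  AddSubgroup.closure FiveTermRels

/-- The extended pre-Bloch group `êP(ℂ)`. -/
abbrev EPreBloch : Type := FreeAbelianGroup CoverT ⧸ relSub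

/-- The variant `êP'(ℂ)` without the transfer relations. -/
abbrev EPreBloch' : Type := FreeAbelianGroup CoverT ⧸ relSub'

/-- The class `[z, p, q] ∈ êP(ℂ)` (junk value `0` if `z ∈ {0,1}`). -/
def cls (z : ℂ) (p q : ℤ) : EPreBloch :=
  if h : Reg z then QuotientAddGroup.mk (genOf z h p q) else 0

/-- The class `[z, p, q] ∈ êP'(ℂ)` (junk value `0` if `z ∈ {0,1}`). -/
def cls' (z : ℂ) (p q : ℤ) : EPreBloch' :=
  if h : Reg z then QuotientAddGroup.mk (genOf z h p q) else 0

/-- `ℂ ∧_ℤ ℂ`, the second exterior power of `ℂ` as a `ℤ`-module. -/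
abbrev L2C : Type := ↥(⋀[ℤ]^2 ℂ)

/-- The wedge `a ∧ b ∈ ℂ ∧_ℤ ℂ`. -/
def wedge (a b : ℂ) : L2C :=
  ⟨ExteriorAlgebra.ιMulti ℤ 2 ![a, b],
   ExteriorAlgebra.ιMulti_range ℤ 2 (Set.mem_range_self _)⟩

def nuFree : FreeAbelianGroup CoverT →+ L2C :=
  FreeAbelianGroup.lift fun w : CoverT => wedge w.1.1 w.1.2

/-- The homomorphism `ν : êP(ℂ) → ℂ ∧_ℤ ℂ`. -/
def nuHom : EPreBloch →+ L2C :=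
  if h : ∀ a ∈ relSub, nuFree a = 0 then QuotientAddGroup.lift relSub nuFree h else 0

/-- The homomorphism `ν : êP'(ℂ) → ℂ ∧_ℤ ℂ`. -/
def nuHom' : EPreBloch' →+ L2C :=
  if h : ∀ a ∈ relSub', nuFree a = 0 then QuotientAddGroup.lift relSub' nuFree h else 0

/-- The extended Bloch group `êB(ℂ) = ker ν`. -/
def EBloch : AddSubgroup EPreBloch := nuHom.ker

/-- `êB'(ℂ) = ker ν` on `êP'(ℂ)`. -/
def EBloch' : AddSubgroup EPreBloch' := nuHom'.ker

/-- The component `X₀₀` of `𝓒` (both fiber coordinates even). -/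
def X00 : Set (ℂ × ℂ) := {w | ∃ z : ℂ, Reg z ∧ ∃ p q : ℤ, w = pt z (2 * p) (2 * q)}

abbrev X00T : Type := ↥X00

lemma pt_mem_X00 {z : ℂ} (h : Reg z) (p q : ℤ) : pt z (2 * p) (2 * q) ∈ X00 :=
  ⟨z, h, p, q, rfl⟩

/-- The generator `(z; 2p, 2q)` of the free abelian group on `X₀₀`. -/
def genOf₀ (z : ℂ) (h : Reg z) (p q : ℤ) : FreeAbelianGroup X00T :=
  FreeAbelianGroup.of ⟨pt z (2 * p) (2 * q), pt_mem_X00 h p q⟩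

/-- The five term relators coming from `𝓕𝓣̂ ∩ (X₀₀)⁵`. -/
def FiveTermRels₀ : Set (FreeAbelianGroup X00T) :=
  {a | ∃ w : Fin 5 → ℂ × ℂ, w ∈ FThat ∧ ∃ hc : ∀ i, w i ∈ X00,
    a = ∑ i : Fin 5, (-1 : ℤ) ^ (i : ℕ) • FreeAbelianGroup.of (⟨w i, hc i⟩ : X00T)}

def relSub₀ : AddSubgroup (FreeAbelianGroup X00T) := AddSubgroup.closure FiveTermRels₀

/-- The true extended pre-Bloch group `êêP(ℂ)`. -/
abbrev EEPreBloch : Type := FreeAbelianGroup X00T ⧸ relSub₀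

/-- The class `[z, 2p, 2q] ∈ êêP(ℂ)` (junk value `0` if `z ∈ {0,1}`). -/
def cls₀ (z : ℂ) (p q : ℤ) : EEPreBloch :=
  if h : Reg z then QuotientAddGroup.mk (genOf₀ z h p q) else 0

def nuFree₀ : FreeAbelianGroup X00T →+ L2C :=
  FreeAbelianGroup.lift fun w : X00T => wedge w.1.1 w.1.2

/-- The homomorphism `ν̂ : êêP(ℂ) → ℂ ∧_ℤ ℂ`. -/
def nuHom₀ : EEPreBloch →+ L2C :=
  if h : ∀ a ∈ relSub₀, nuFree₀ a = 0 then QuotientAddGroup.lift relSub₀ nuFree₀ h else 0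

/-- The true extended Bloch group `êêB(ℂ) = ker ν̂`. -/
def EEBloch : AddSubgroup EEPreBloch := nuHom₀.ker

/-- The Rogers dilogarithm `𝓡(z) = ½ log z log(1-z) - ∫₀ᶻ log(1-t)/t dt` (straight segment,
parametrized by `t = s z`). -/
def rogers (z : ℂ) : ℂ :=
  (1 / 2) * Complex.log z * Complex.log (1 - z) -
    ∫ s in (0:ℝ)..(1:ℝ), Complex.log (1 - (s : ℂ) * z) / (s : ℂ)

/-- `R(z; p, q) = 𝓡(z) + (πi/2)(p log(1-z) + q log z) - π²/6`. -/
def Rfun (z : ℂ) (p q : ℤ) : ℂ :=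
  rogers z + (Cpi * I / 2) * (p * Complex.log (1 - z) + q * Complex.log z) - Cpi ^ 2 / 6

/-- `R̂(z; 2p, 2q) = 𝓡(z) + πi(p log(1-z) + q log z) - π²/6`. -/
def Rhat (z : ℂ) (p q : ℤ) : ℂ :=
  rogers z + Cpi * I * (p * Complex.log (1 - z) + q * Complex.log z) - Cpi ^ 2 / 6

/-- `ℂ / π²ℤ`. -/
abbrev ModPiSq : Type := ℂ ⧸ AddSubgroup.zmultiples (Cpi ^ 2)

/-- `ℂ / 2π²ℤ`. -/
abbrev Mod2PiSq : Type := ℂ ⧸ AddSubgroup.zmultiples (2 * Cpi ^ 2)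

abbrev RegT : Type := {z : ℂ // Reg z}

def pbGen (z : ℂ) (h : Reg z) : FreeAbelianGroup RegT := FreeAbelianGroup.of ⟨z, h⟩

/-- The five term relators for the classical pre-Bloch group. -/
def pbRels : Set (FreeAbelianGroup RegT) :=
  {a | ∃ x y : ℂ, ∃ hx : Reg x, ∃ hy : Reg y, x ≠ y ∧
    ∃ h2 : Reg (y / x), ∃ h3 : Reg ((1 - x⁻¹) / (1 - y⁻¹)), ∃ h4 : Reg ((1 - x) / (1 - y)),
    a = pbGen x hx - pbGen y hy + pbGen (y / x) h2 -
        pbGen ((1 - x⁻¹) / (1 - y⁻¹)) h3 + pbGen ((1 - x) / (1 - y)) h4}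

def pbSub : AddSubgroup (FreeAbelianGroup RegT) := AddSubgroup.closure pbRels

/-- The classical pre-Bloch group `P(ℂ)`. -/
abbrev PreBloch : Type := FreeAbelianGroup RegT ⧸ pbSub

/-- The class `[z] ∈ P(ℂ)` (junk value `0` if `z ∈ {0,1}`). -/
def pbCls (z : ℂ) : PreBloch :=
  if h : Reg z then QuotientAddGroup.mk (pbGen z h) else 0

/-- `ℂ* ∧_ℤ ℂ*`, the second exterior power of the multiplicative group `ℂ*` as `ℤ`-module. -/
abbrev L2CU : Type := ↥(⋀[ℤ]^2 (Additive ℂˣ))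

/-- The wedge `a ∧ b ∈ ℂ* ∧_ℤ ℂ*`. -/
def wedgeU (a b : ℂˣ) : L2CU :=
  ⟨ExteriorAlgebra.ιMulti ℤ 2 ![Additive.ofMul a, Additive.ofMul b],
   ExteriorAlgebra.ιMulti_range ℤ 2 (Set.mem_range_self _)⟩

def nuPBFree : FreeAbelianGroup RegT →+ L2CU :=
  FreeAbelianGroup.lift fun z : RegT =>
    2 • wedgeU (Units.mk0 z.1 z.2.1) (Units.mk0 (1 - z.1) (sub_ne_zero_of_ne (Ne.symm z.2.2)))

/-- The homomorphism `P(ℂ) → ℂ* ∧_ℤ ℂ*`, `[z] ↦ 2 (z ∧ (1-z))`. -/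
def nuPB : PreBloch →+ L2CU :=
  if h : ∀ a ∈ pbSub, nuPBFree a = 0 then QuotientAddGroup.lift pbSub nuPBFree h else 0

/-- The classical Bloch group `B(ℂ)`. -/
def Bloch : AddSubgroup PreBloch := nuPB.ker

/-- The roots of unity in `ℂ*`. -/
def muStar : Set ℂˣ := {ζ | ∃ n : ℕ, 0 < n ∧ ζ ^ n = 1}

abbrev SL2C := Matrix.SpecialLinearGroup (Fin 2) ℂ

/-- `PSL(2,ℂ) = SL(2,ℂ)/{±1}` as a discrete group. -/
abbrev PSL2C := SL2C ⧸ Subgroup.center SL2C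

/-- The boundary map `C₃ → C₂` of the inhomogeneous bar complex computing `H₃(PSL(2,ℂ);ℤ)`. -/
def d3 : FreeAbelianGroup (Fin 3 → PSL2C) →+ FreeAbelianGroup (Fin 2 → PSL2C) :=
  FreeAbelianGroup.lift fun g =>
    FreeAbelianGroup.of ![g 1, g 2] - FreeAbelianGroup.of ![g 0 * g 1, g 2] +
      FreeAbelianGroup.of ![g 0, g 1 * g 2] - FreeAbelianGroup.of ![g 0, g 1]

/-- The boundary map `C₄ → C₃` of the inhomogeneous bar complex computing `H₃(PSL(2,ℂ);ℤ)`. -/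
def d4 : FreeAbelianGroup (Fin 4 → PSL2C) →+ FreeAbelianGroup (Fin 3 → PSL2C) :=
  FreeAbelianGroup.lift fun g =>
    FreeAbelianGroup.of ![g 1, g 2, g 3] - FreeAbelianGroup.of ![g 0 * g 1, g 2, g 3] +
      FreeAbelianGroup.of ![g 0, g 1 * g 2, g 3] - FreeAbelianGroup.of ![g 0, g 1, g 2 * g 3] +
      FreeAbelianGroup.of ![g 0, g 1, g 2]

/-- `H₃(PSL(2,ℂ);ℤ)`, defined as homology of the inhomogeneous bar complex. -/
abbrev H3PSL2C : Type := ↥d3.ker ⧸ ((d4.range).addSubgroupOf d3.ker)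

/-- The set of combinatorial flattenings. -/
def Flattenings : Set (ℂ × ℂ × ℂ) :=
  {w | w.1 + w.2.1 + w.2.2 = 0 ∧ ∃ z : ℂ, Reg z ∧ ∃ p q r : ℤ,
    w.1 = Complex.log z + p * (Cpi * I) ∧
    w.2.1 = -Complex.log (1 - z) + q * (Cpi * I) ∧
    w.2.2 = Complex.log (1 - z) - Complex.log z + r * (Cpi * I)}

/-- The map `ℓ : 𝓒 → ℂ³`. -/
def ellMap (w : ℂ × ℂ) : ℂ × ℂ × ℂ := (w.1, w.2, -w.1 - w.2)

/-- The element `κ = [x,1,1] + [x,0,0] - [x,1,0] - [x,0,1] ∈ êP'(ℂ)`. -/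
def kap (x : ℂ) : EPreBloch' := cls' x 1 1 + cls' x 0 0 - cls' x 1 0 - cls' x 0 1

/-- The natural projection `êP'(ℂ) → êP(ℂ)`. -/
def projP : EPreBloch' →+ EPreBloch :=
  QuotientAddGroup.map relSub' relSub (AddMonoidHom.id _)
    (by
      rw [AddSubgroup.comap_id]
      exact AddSubgroup.closure_mono Set.subset_union_left)

lemma wedge_coe (a b : ℂ) :
    ((wedge a b : L2C) : ExteriorAlgebra ℤ ℂ) = ExteriorAlgebra.ι ℤ a * ExteriorAlgebra.ι ℤ b := by
  simp [wedge, ExteriorAlgebra.ιMulti_apply]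

lemma wedge_self (a : ℂ) : wedge a a = 0 := by
  apply Subtype.ext
  rw [wedge_coe, ExteriorAlgebra.ι_sq_zero, ZeroMemClass.coe_zero]

lemma wedge_add_left (a b c : ℂ) : wedge (a + b) c = wedge a c + wedge b c := by
  apply Subtype.ext
  simp only [AddMemClass.coe_add, wedge_coe, map_add, add_mul]

lemma wedge_add_right (a b c : ℂ) : wedge a (b + c) = wedge a b + wedge a c := by
  apply Subtype.ext
  simp only [AddMemClass.coe_add, wedge_coe, map_add, mul_add]

lemma wedge_sub_left (a b c : ℂ) : wedge (a - b) c = wedge a c - wedge b c := by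
  rw [eq_sub_iff_add_eq, ← wedge_add_left, sub_add_cancel]

lemma wedge_sub_right (a b c : ℂ) : wedge a (b - c) = wedge a b - wedge a c := by
  rw [eq_sub_iff_add_eq, ← wedge_add_right, sub_add_cancel]

lemma wedge_swap (a b : ℂ) : wedge a b = -wedge b a := by
  have h := wedge_self (a + b)
  rw [wedge_add_left, wedge_add_right, wedge_add_right, wedge_self, wedge_self, zero_add,
    add_zero] at h
  exact eq_neg_of_add_eq_zero_left h

lemma wedge_int_mul_int_mul (m n : ℤ) (a : ℂ) : wedge (m * a) (n * a) = 0 := by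
  apply Subtype.ext
  rw [wedge_coe, ← zsmul_eq_mul, ← zsmul_eq_mul, map_zsmul, map_zsmul, smul_mul_smul_comm,
    ExteriorAlgebra.ι_sq_zero, smul_zero, ZeroMemClass.coe_zero]

/-- The linear relations between the logarithm branches of a lifted five term tuple. -/
structure LogRelations (w : Fin 5 → ℂ × ℂ) : Prop where
  fst_two : (w 2).1 = (w 1).1 - (w 0).1
  fst_three : (w 3).1 = (w 2).1 + (w 4).1
  fst_four : (w 4).1 = (w 1).2 - (w 0).2
  snd_three : (w 3).2 = (w 2).2 - (w 1).2
  snd_four : (w 4).2 = (w 3).2 - (w 0).1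

lemma LogRelations.covAct {w : Fin 5 → ℂ × ℂ} (h : LogRelations w) {v : Fin 5 → ℤ × ℤ}
    (hv : v ∈ Vset) : LogRelations fun i => covAct (v i) (w i) := by
  obtain ⟨p₀, p₁, q₀, q₁, q₂, rfl⟩ := hv
  constructor <;> simp [ExtendedBloch.covAct]
  · linear_combination h.fst_two
  · linear_combination h.fst_three
  · linear_combination h.fst_four
  · linear_combination h.snd_three
  · linear_combination h.snd_four

lemma LogRelations.wedge_sum {w : Fin 5 → ℂ × ℂ} (h : LogRelations w) :
    ∑ i : Fin 5, (-1 : ℤ) ^ (i : ℕ) • wedge (w i).1 (w i).2 = 0 := by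
  simp only [Fin.sum_univ_five, h.snd_four, h.fst_three, h.snd_three, h.fst_two, h.fst_four,
    wedge_add_left, wedge_sub_left, wedge_sub_right, wedge_self]
  rw [wedge_swap (w 1).2 (w 0).1, wedge_swap (w 0).2 (w 0).1]
  norm_num [Fin.val_ofNat]
  abel

lemma exp_int_mul_two_pi_I (n : ℤ) : exp (2 * (n * (Cpi * I))) = 1 := by
  rw [Complex.exp_eq_one_iff]
  exact ⟨n, by simp only [Cpi]; ring⟩

lemma LiesOver.exp_two_mul_fst {w : ℂ × ℂ} {z : ℂ} (h : LiesOver w z) :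
    exp (2 * w.1) = z ^ 2 := by
  obtain ⟨hz, p, q, rfl⟩ := h
  rw [pt, mul_add, exp_add, exp_int_mul_two_pi_I, mul_one, two_mul, exp_add, exp_log hz.1, sq]

lemma LiesOver.exp_two_mul_snd {w : ℂ × ℂ} {z : ℂ} (h : LiesOver w z) :
    exp (2 * w.2) = ((1 - z) ^ 2)⁻¹ := by
  obtain ⟨hz, p, q, rfl⟩ := h
  have hz' : 1 - z ≠ 0 := sub_ne_zero.mpr hz.2.symm
  rw [pt, mul_add, exp_add, exp_int_mul_two_pi_I, mul_one, mul_neg, exp_neg, two_mul, exp_add,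
    exp_log hz', sq]

lemma countable_setOf_exp_two_mul_eq_one : {a : ℂ | exp (2 * a) = 1}.Countable := by
  refine (Set.countable_range fun n : ℤ => (n : ℂ) * (Real.pi * I)).mono ?_
  intro a ha
  obtain ⟨n, hn⟩ := Complex.exp_eq_one_iff.mp ha
  exact ⟨n, by linear_combination -hn / 2⟩

/-- A continuous function on `FTpre` with values in `πiℤ` that vanishes at the base point vanishes
on the component of the base point. -/
lemma eq_zero_of_mem_FThat₀ {f : (Fin 5 → ℂ × ℂ) → ℂ} (hf : Continuous f)
    (hexp : ∀ w ∈ FTpre, exp (2 * f w) = 1) (hbase : f basePt = 0) {w : Fin 5 → ℂ × ℂ}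
    (hw : w ∈ FThat₀) : f w = 0 := by
  have hmem : basePt ∈ FThat₀ :=
    mem_connectedComponentIn (connectedComponentIn_nonempty_iff.mp ⟨w, hw⟩)
  have hsub : (f '' FThat₀).Subsingleton :=
    countable_setOf_exp_two_mul_eq_one.isTotallyDisconnected _ (by
        rintro _ ⟨u, hu, rfl⟩
        exact hexp u (connectedComponentIn_subset _ _ hu))
      (isPreconnected_connectedComponentIn.image f hf.continuousOn)
  exact (hsub (Set.mem_image_of_mem f hw) (Set.mem_image_of_mem f hmem)).trans hbase

/-- On `FTpre` the identities of `LogRelations` hold up to integer multiples of `πi`. -/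
lemma exp_two_mul_logRelations {w : Fin 5 → ℂ × ℂ} (hw : w ∈ FTpre) :
    exp (2 * ((w 2).1 - (w 1).1 + (w 0).1)) = 1 ∧
    exp (2 * ((w 2).1 - (w 3).1 + (w 4).1)) = 1 ∧
    exp (2 * ((w 4).1 - (w 1).2 + (w 0).2)) = 1 ∧
    exp (2 * ((w 3).2 - (w 2).2 + (w 1).2)) = 1 ∧
    exp (2 * ((w 4).2 - (w 3).2 + (w 0).1)) = 1 := by
  obtain ⟨_, ⟨x, y, hx, hy, hxy, rfl⟩, h⟩ := hw
  have hx0 := hx.1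
  have hy0 := hy.1
  have hx1 : 1 - x ≠ 0 := sub_ne_zero.mpr hx.2.symm
  have hy1 : 1 - y ≠ 0 := sub_ne_zero.mpr hy.2.symm
  have hxy' : x - y ≠ 0 := sub_ne_zero.mpr hxy
  have e3 : (1 - x⁻¹) / (1 - y⁻¹) = y * (1 - x) / (x * (1 - y)) := by
    have : y - 1 ≠ 0 := sub_ne_zero.mpr hy.2
    have hy2 : 1 - y⁻¹ = (y - 1) / y := by field_simp
    rw [hy2, div_div_eq_mul_div, div_eq_div_iff this (mul_ne_zero hx0 hy1)]
    field_simp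
    ring
  have e2' : 1 - y / x = (x - y) / x := by field_simp
  have e3' : 1 - y * (1 - x) / (x * (1 - y)) = (x - y) / (x * (1 - y)) := by field_simp; ring
  have e4' : 1 - (1 - x) / (1 - y) = (x - y) / (1 - y) := by field_simp; ring
  have a0 : exp (2 * (w 0).1) = x ^ 2 := (h 0).exp_two_mul_fst
  have a1 : exp (2 * (w 1).1) = y ^ 2 := (h 1).exp_two_mul_fst
  have a2 : exp (2 * (w 2).1) = (y / x) ^ 2 := (h 2).exp_two_mul_fst
  have a3 : exp (2 * (w 3).1) = ((1 - x⁻¹) / (1 - y⁻¹)) ^ 2 := (h 3).exp_two_mul_fst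
  have a4 : exp (2 * (w 4).1) = ((1 - x) / (1 - y)) ^ 2 := (h 4).exp_two_mul_fst
  have b0 : exp (2 * (w 0).2) = ((1 - x) ^ 2)⁻¹ := (h 0).exp_two_mul_snd
  have b1 : exp (2 * (w 1).2) = ((1 - y) ^ 2)⁻¹ := (h 1).exp_two_mul_snd
  have b2 : exp (2 * (w 2).2) = ((1 - y / x) ^ 2)⁻¹ := (h 2).exp_two_mul_snd
  have b3 : exp (2 * (w 3).2) = ((1 - (1 - x⁻¹) / (1 - y⁻¹)) ^ 2)⁻¹ := (h 3).exp_two_mul_snd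
  have b4 : exp (2 * (w 4).2) = ((1 - (1 - x) / (1 - y)) ^ 2)⁻¹ := (h 4).exp_two_mul_snd
  rw [e3] at a3
  rw [e2'] at b2
  rw [e3, e3'] at b3
  rw [e4'] at b4
  simp only [mul_add, mul_sub, exp_add, exp_sub, a0, a1, a2, a3, a4, b0, b1, b2, b3, b4]
  refine ⟨?_, ?_, ?_, ?_, ?_⟩ <;> field_simp

lemma sub_add_eq_zero_of_exp_eq_one {a b c : ℂ} (hexp : exp (a - b + c) = 1)
    (ha : 0 < a.im ∧ a.im < Real.pi) (hb : 0 < b.im ∧ b.im < Real.pi)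
    (hc : 0 < c.im ∧ c.im < Real.pi) : a - b + c = 0 := by
  obtain ⟨n, hn⟩ := Complex.exp_eq_one_iff.mp hexp
  have him : a.im - b.im + c.im = n * (2 * Real.pi) := by
    simpa using congrArg Complex.im hn
  have h1 : (n : ℝ) < 1 := by nlinarith [Real.pi_pos]
  have h2 : (-1 : ℝ) < n := by nlinarith [Real.pi_pos]
  have h0 : n = 0 := by
    have : n < 1 := by exact_mod_cast h1
    have : -1 < n := by exact_mod_cast h2
    omega
  simpa [h0] using hn

lemma log_im_mem_of_im_pos {z : ℂ} (hz : 0 < z.im) :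
    0 < (log z).im ∧ (log z).im < Real.pi := by
  rw [log_im]
  refine ⟨lt_of_le_of_ne (arg_nonneg_iff.mpr hz.le) fun h => ?_, arg_lt_pi_iff.mpr (.inr hz.ne')⟩
  exact hz.ne' (arg_eq_zero_iff.mp h.symm).2

lemma neg_log_one_sub_im_mem_of_im_pos {z : ℂ} (hz : 0 < z.im) :
    0 < (-log (1 - z)).im ∧ (-log (1 - z)).im < Real.pi := by
  have h : (1 - z).im < 0 := by simpa using hz
  rw [neg_im, log_im]
  exact ⟨neg_pos.mpr (arg_neg_iff.mpr h), by linarith [neg_pi_lt_arg (1 - z)]⟩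

lemma basePt_zero : basePt 0 = (log ((1 + I) / 4), -log (1 - (1 + I) / 4)) := by
  simp [basePt, pt, ftTuple]

lemma basePt_one : basePt 1 = (log I, -log (1 - I)) := by
  simp [basePt, pt, ftTuple]

lemma basePt_two : basePt 2 = (log (2 + 2 * I), -log (1 - (2 + 2 * I))) := by
  have h : I / ((1 + I) / 4) = 2 + 2 * I := by
    have : (1 + I) ≠ 0 := fun h => by simpa using congrArg Complex.im h
    field_simp
    linear_combination (-2 : ℂ) * I_sq
  rw [← h]
  simp [basePt, pt, ftTuple]

lemma basePt_three :
    basePt 3 = (log ((1 + 3 * I) / 2), -log (1 - (1 + 3 * I) / 2)) := by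
  have h : (1 - ((1 + I) / 4)⁻¹) / (1 - I⁻¹) = (1 + 3 * I) / 2 := by
    have h1 : (1 + I) ≠ 0 := fun h => by simpa using congrArg Complex.im h
    rw [inv_I, sub_neg_eq_add]
    field_simp
    linear_combination (-7 - 3 * I) * I_sq
  rw [← h]
  simp [basePt, pt, ftTuple]

lemma basePt_four : basePt 4 = (log ((2 + I) / 4), -log (1 - (2 + I) / 4)) := by
  have h : (1 - (1 + I) / 4) / (1 - I) = (2 + I) / 4 := by
    have h1 : (1 - I) ≠ 0 := fun h => by simpa using congrArg Complex.im h
    field_simp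
    linear_combination I_sq
  rw [← h]
  simp [basePt, pt, ftTuple]

lemma basePt_logRelations :
    (basePt 2).1 - (basePt 1).1 + (basePt 0).1 = 0 ∧
    (basePt 2).1 - (basePt 3).1 + (basePt 4).1 = 0 ∧
    (basePt 4).1 - (basePt 1).2 + (basePt 0).2 = 0 ∧
    (basePt 3).2 - (basePt 2).2 + (basePt 1).2 = 0 ∧
    (basePt 4).2 - (basePt 3).2 + (basePt 0).1 = 0 := by
  have p0 : 0 < ((1 + I) / 4).im := by simp
  have p1 : 0 < I.im := by simp
  have p2 : 0 < (2 + 2 * I).im := by simp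
  have p3 : 0 < ((1 + 3 * I) / 2).im := by simp
  have p4 : 0 < ((2 + I) / 4).im := by simp
  have ne {z : ℂ} (hz : 0 < z.im) : z ≠ 0 := fun h => by simp [h] at hz
  have ne' {z : ℂ} (hz : 0 < z.im) : 1 - z ≠ 0 := fun h => by
    simp [← sub_eq_zero.mp h] at hz
  rw [basePt_zero, basePt_one, basePt_two, basePt_three, basePt_four]
  refine ⟨sub_add_eq_zero_of_exp_eq_one ?_ (log_im_mem_of_im_pos p2) (log_im_mem_of_im_pos p1)
      (log_im_mem_of_im_pos p0),
    sub_add_eq_zero_of_exp_eq_one ?_ (log_im_mem_of_im_pos p2) (log_im_mem_of_im_pos p3)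
      (log_im_mem_of_im_pos p4),
    sub_add_eq_zero_of_exp_eq_one ?_ (log_im_mem_of_im_pos p4) (neg_log_one_sub_im_mem_of_im_pos p1)
      (neg_log_one_sub_im_mem_of_im_pos p0),
    sub_add_eq_zero_of_exp_eq_one ?_ (neg_log_one_sub_im_mem_of_im_pos p3)
      (neg_log_one_sub_im_mem_of_im_pos p2) (neg_log_one_sub_im_mem_of_im_pos p1),
    sub_add_eq_zero_of_exp_eq_one ?_ (neg_log_one_sub_im_mem_of_im_pos p4)
      (neg_log_one_sub_im_mem_of_im_pos p3) (log_im_mem_of_im_pos p0)⟩ <;>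
  simp only [exp_add, exp_sub, exp_neg, exp_log (ne p0), exp_log (ne p1), exp_log (ne p2),
    exp_log (ne p3), exp_log (ne p4), exp_log (ne' p0), exp_log (ne' p1), exp_log (ne' p2),
    exp_log (ne' p3), exp_log (ne' p4)]
  · have := ne p1
    field_simp
    linear_combination (2 : ℂ) * I_sq
  · rw [div_mul_eq_mul_div, div_eq_one_iff_eq (ne p3)]
    linear_combination (1 / 2 : ℂ) * I_sq
  · rw [div_inv_eq_mul, mul_inv_eq_one₀ (ne' p0)]
    linear_combination (-1 / 4 : ℂ) * I_sq
  · rw [div_inv_eq_mul, mul_inv_eq_one₀ (ne' p1), inv_mul_eq_iff_eq_mul₀ (ne' p3)]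
    linear_combination (-3 / 2 : ℂ) * I_sq
  · rw [div_inv_eq_mul, mul_assoc, inv_mul_eq_one₀ (ne' p4)]
    linear_combination (3 / 8 : ℂ) * I_sq

lemma logRelations_of_mem_FThat₀ {w : Fin 5 → ℂ × ℂ} (hw : w ∈ FThat₀) : LogRelations w := by
  obtain ⟨h1, h2, h3, h4, h5⟩ := basePt_logRelations
  have k1 := eq_zero_of_mem_FThat₀ (f := fun w => (w 2).1 - (w 1).1 + (w 0).1) (by fun_prop)
    (fun u hu => (exp_two_mul_logRelations hu).1) h1 hw
  have k2 := eq_zero_of_mem_FThat₀ (f := fun w => (w 2).1 - (w 3).1 + (w 4).1) (by fun_prop)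
    (fun u hu => (exp_two_mul_logRelations hu).2.1) h2 hw
  have k3 := eq_zero_of_mem_FThat₀ (f := fun w => (w 4).1 - (w 1).2 + (w 0).2) (by fun_prop)
    (fun u hu => (exp_two_mul_logRelations hu).2.2.1) h3 hw
  have k4 := eq_zero_of_mem_FThat₀ (f := fun w => (w 3).2 - (w 2).2 + (w 1).2) (by fun_prop)
    (fun u hu => (exp_two_mul_logRelations hu).2.2.2.1) h4 hw
  have k5 := eq_zero_of_mem_FThat₀ (f := fun w => (w 4).2 - (w 3).2 + (w 0).1) (by fun_prop)
    (fun u hu => (exp_two_mul_logRelations hu).2.2.2.2) h5 hw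
  constructor
  · linear_combination k1
  · linear_combination -k2
  · linear_combination k3
  · linear_combination k4
  · linear_combination k5

lemma nuFree_of (w : CoverT) : nuFree (FreeAbelianGroup.of w) = wedge w.1.1 w.1.2 :=
  FreeAbelianGroup.lift_apply_of _ _

lemma nuFree_fiveTermRels {a : FreeAbelianGroup CoverT} (ha : a ∈ FiveTermRels) :
    nuFree a = 0 := by
  obtain ⟨_, ⟨w, hw, v, hv, rfl⟩, _, rfl⟩ := ha
  simp only [map_sum, map_zsmul, nuFree_of]
  exact ((logRelations_of_mem_FThat₀ hw).covAct hv).wedge_sum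

lemma nuFree_transferRels {a : FreeAbelianGroup CoverT} (ha : a ∈ TransferRels) :
    nuFree a = 0 := by
  obtain ⟨z, _, p, q, p', q', rfl⟩ := ha
  simp only [map_add, map_sub, genOf, nuFree_of, pt, wedge_add_left, wedge_add_right,
    wedge_int_mul_int_mul]
  abel

/-- the assignment `(z;p,q) ↦ (Log z + pπi) ∧ (-Log(1-z) + qπi)` vanishes on every
lifted five-term relation and every transfer relation, and induces a homomorphism
`ν : êP(ℂ) → ℂ ∧_ℤ ℂ` with `ν[z,p,q] = (Log z + pπi) ∧ (-Log(1-z) + qπi)`. -/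
theorem stmt2 :
    (∀ a ∈ FiveTermRels ∪ TransferRels, nuFree a = 0) ∧
    ∃ ν : EPreBloch →+ L2C,
      (∀ a : FreeAbelianGroup CoverT, ν (QuotientAddGroup.mk a) = nuFree a) ∧
      ∀ (z : ℂ), Reg z → ∀ (p q : ℤ),
        ν (cls z p q) =
          wedge (Complex.log z + p * (Cpi * I)) (-Complex.log (1 - z) + q * (Cpi * I)) := by
  have hrel : ∀ a ∈ FiveTermRels ∪ TransferRels, nuFree a = 0 := by
    rintro a (ha | ha)
    · exact nuFree_fiveTermRels ha
    · exact nuFree_transferRels ha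
  have hker : relSub ≤ nuFree.ker := (AddSubgroup.closure_le _).mpr hrel
  refine ⟨hrel, QuotientAddGroup.lift relSub nuFree hker, fun a => rfl, fun z hz p q => ?_⟩
  rw [cls, dif_pos hz]
  exact nuFree_of _

end ExtendedBloch

end
end

section
/- Fix integers p₀,p₁,p₂,p₃,p₄ and q₀,q₁,q₂,q₃,q₄. The sum Σᵢ₌₀⁴ (-1)ⁱ (pᵢ Log(1-xᵢ) + qᵢ Log xᵢ) vanishes for every tuple (x₀,…,x₄) ∈ FT⁺ if and only if p₂ = p₁-p₀, p₃ = p₁-p₀+q₁-q₀, q₃ = q₂-q₁, p₄ = q₁-q₀ and q₄ = q₂-q₁-p₀. -/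
open Complex
open scoped Classical

noncomputable section

namespace ExtendedBloch

lemma log_mul_of_im_pos_of_im_neg {z w : ℂ} (hz : 0 < z.im) (hw : w.im < 0) :
    log (z * w) = log z + log w := by
  have hz₀ : z ≠ 0 := by rintro rfl; simp at hz
  have hw₀ : w ≠ 0 := by rintro rfl; simp at hw
  refine (log_mul_eq_add_log_iff hz₀ hw₀).2 ⟨?_, ?_⟩
  · linarith [arg_nonneg_iff.2 hz.le, neg_pi_lt_arg w]
  · linarith [arg_neg_iff.2 hw, arg_le_pi z]

lemma log_inv_of_im_ne_zero {z : ℂ} (hz : z.im ≠ 0) : log z⁻¹ = -log z :=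
  log_inv z (arg_lt_pi_iff.2 (Or.inr hz)).ne

lemma inv_im_neg {z : ℂ} (hz : 0 < z.im) : z⁻¹.im < 0 := by
  have hz₀ : z ≠ 0 := by rintro rfl; simp at hz
  rw [inv_im]
  exact div_neg_of_neg_of_pos (neg_neg_of_pos hz) (normSq_pos.2 hz₀)

lemma inv_im_pos {z : ℂ} (hz : z.im < 0) : 0 < z⁻¹.im := by
  have hz₀ : z ≠ 0 := by rintro rfl; simp at hz
  rw [inv_im]
  exact div_pos (neg_pos_of_neg hz) (normSq_pos.2 hz₀)

lemma log_div_of_im_pos {z w : ℂ} (hz : 0 < z.im) (hw : 0 < w.im) :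
    log (z / w) = log z - log w := by
  rw [div_eq_mul_inv, log_mul_of_im_pos_of_im_neg hz (inv_im_neg hw),
    log_inv_of_im_ne_zero hw.ne', sub_eq_add_neg]

lemma log_div_of_im_neg {z w : ℂ} (hz : z.im < 0) (hw : w.im < 0) :
    log (z / w) = log z - log w := by
  rw [div_eq_inv_mul, log_mul_of_im_pos_of_im_neg (inv_im_pos hw) hz,
    log_inv_of_im_ne_zero hw.ne, neg_add_eq_sub]

/-- On `FT⁺` the alternating sum is a combination of five logarithms, with no branch
corrections. -/
lemma sum_ftTuple (p q : Fin 5 → ℤ) {x y : ℂ} (h : ∀ i, ftTuple x y i ∈ UHP) :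
    ∑ i : Fin 5, (-1 : ℂ) ^ (i : ℕ) *
        (p i * log (1 - ftTuple x y i) + q i * log (ftTuple x y i)) =
      ((q 0 - q 2 + q 3 + p 4 : ℤ) : ℂ) * log x + ((q 2 - q 1 - q 3 : ℤ) : ℂ) * log y +
        ((p 0 - q 3 + q 4 : ℤ) : ℂ) * log (1 - x) +
        ((p 3 + q 3 - p 1 - p 4 - q 4 : ℤ) : ℂ) * log (1 - y) +
        ((p 2 - p 3 + p 4 : ℤ) : ℂ) * log (1 - y / x) := by
  have h0 : 0 < x.im := h 0
  have h1 : 0 < y.im := h 1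
  have h2 : 0 < (y / x).im := h 2
  have h3 : 0 < ((1 - x⁻¹) / (1 - y⁻¹)).im := h 3
  have hx : x ≠ 0 := by rintro rfl; simp at h0
  have hy : y ≠ 0 := by rintro rfl; simp at h1
  have one_sub_im {z : ℂ} (hz : 0 < z.im) : (1 - z).im < 0 := by simpa using hz
  have hx₁ : 1 - x ≠ 0 := fun h => by simpa [h] using one_sub_im h0
  have hy₁ : 1 - y ≠ 0 := fun h => by simpa [h] using one_sub_im h1
  have hy₂ : 1 - y⁻¹ ≠ 0 := by
    rw [show 1 - y⁻¹ = -(1 - y) / y by field_simp; ring]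
    exact div_ne_zero (neg_ne_zero.2 hy₁) hy
  have e3 : (1 - x⁻¹) / (1 - y⁻¹) = y * (1 - x) / (x * (1 - y)) := by
    have hy₃ : y - 1 ≠ 0 := sub_ne_zero.2 (sub_ne_zero.1 hy₁).symm
    field_simp
    ring
  have l2 : log (y / x) = log y - log x := log_div_of_im_pos h1 h0
  have l4 : log ((1 - x) / (1 - y)) = log (1 - x) - log (1 - y) :=
    log_div_of_im_neg (one_sub_im h0) (one_sub_im h1)
  have l3 : log ((1 - x⁻¹) / (1 - y⁻¹)) = log y - log x + (log (1 - x) - log (1 - y)) := by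
    have := log_div_of_im_pos h3 h2
    rw [show (1 - x⁻¹) / (1 - y⁻¹) / (y / x) = (1 - x) / (1 - y) by rw [e3]; field_simp, l4, l2]
      at this
    linear_combination -this
  have m3 : log (1 - (1 - x⁻¹) / (1 - y⁻¹)) = log (1 - y / x) - log (1 - y) := by
    rw [← log_div_of_im_neg (one_sub_im h2) (one_sub_im h1), e3]
    congr 1
    field_simp
    ring
  have m4 : log (1 - (1 - x) / (1 - y)) = log x + (log (1 - y / x) - log (1 - y)) := by
    rw [← m3, ← log_mul_of_im_pos_of_im_neg h0 (one_sub_im h3), e3]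
    congr 1
    field_simp
    ring
  have s0 : ftTuple x y 0 = x := rfl
  have s1 : ftTuple x y 1 = y := rfl
  have s2 : ftTuple x y 2 = y / x := rfl
  have s3 : ftTuple x y 3 = (1 - x⁻¹) / (1 - y⁻¹) := rfl
  have s4 : ftTuple x y 4 = (1 - x) / (1 - y) := rfl
  rw [Fin.sum_univ_five, s0, s1, s2, s3, s4, m4, m3, l4, l3, l2]
  simp only [Fin.val_zero, Fin.val_one, Fin.val_two, show ((3 : Fin 5) : ℕ) = 3 from rfl,
    show ((4 : Fin 5) : ℕ) = 4 from rfl]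
  push_cast
  ring

lemma ftTuple_mem_FTplus : ftTuple (2 + 5 * I) (3 + 8 * I) ∈ FTplus := by
  refine ⟨⟨_, _, ?_, ?_, ?_, rfl⟩, ?_⟩
  · constructor <;> intro h <;> simpa using congrArg im h
  · constructor <;> intro h <;> simpa using congrArg im h
  · intro h
    have := congrArg re h
    norm_num at this
  · intro i
    fin_cases i <;> simp [ftTuple, UHP, div_im, normSq_apply] <;> norm_num

/-- The integers `29, 73, 26, 68, 10` are multiplicatively independent. -/
lemma eq_zero_of_log_combination_eq_zero {A B C D E : ℤ}
    (h : A * Real.log 29 + B * Real.log 73 + C * Real.log 26 + D * Real.log 68 +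
      E * Real.log 10 = 0) : A = 0 ∧ B = 0 ∧ C = 0 ∧ D = 0 ∧ E = 0 := by
  have hQ : (29 : ℚ) ^ A * 73 ^ B * 26 ^ C * 68 ^ D * 10 ^ E = 1 := by
    have hR : (29 : ℝ) ^ A * 73 ^ B * 26 ^ C * 68 ^ D * 10 ^ E = 1 := by
      refine Real.eq_one_of_pos_of_log_eq_zero (by positivity) ?_
      rw [Real.log_mul (by positivity) (by positivity), Real.log_mul (by positivity) (by positivity),
        Real.log_mul (by positivity) (by positivity), Real.log_mul (by positivity) (by positivity)]
      simpa only [Real.log_zpow] using h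
    apply Rat.cast_injective (α := ℝ)
    simpa using hR
  have key (r : ℕ) [Fact r.Prime] :
      A * (padicValNat r 29 : ℤ) + B * (padicValNat r 73 : ℤ) + C * (padicValNat r 26 : ℤ) +
        D * (padicValNat r 68 : ℤ) + E * (padicValNat r 10 : ℤ) = 0 := by
    have := congrArg (padicValRat r) hQ
    rw [padicValRat.mul (by positivity) (by positivity),
      padicValRat.mul (by positivity) (by positivity),
      padicValRat.mul (by positivity) (by positivity),
      padicValRat.mul (by positivity) (by positivity), padicValRat.one] at this
    simp only [padicValRat.zpow] at this
    exact_mod_cast this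
  have : Fact (Nat.Prime 29) := ⟨by norm_num⟩
  have : Fact (Nat.Prime 73) := ⟨by norm_num⟩
  have : Fact (Nat.Prime 13) := ⟨by norm_num⟩
  have : Fact (Nat.Prime 17) := ⟨by norm_num⟩
  have : Fact (Nat.Prime 5) := ⟨by norm_num⟩
  refine ⟨?_, ?_, ?_, ?_, ?_⟩
  · simpa [padicValNat.eq_zero_of_not_dvd, padicValNat.eq_zero_iff] using key 29
  · simpa [padicValNat.eq_zero_of_not_dvd, padicValNat.eq_zero_iff] using key 73
  · simpa [padicValNat.eq_zero_of_not_dvd, padicValNat.eq_zero_iff] using key 13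
  · simpa [padicValNat.eq_zero_of_not_dvd, padicValNat.eq_zero_iff] using key 17
  · simpa [padicValNat.eq_zero_of_not_dvd, padicValNat.eq_zero_iff] using key 5

lemma log_re_eq_half_log_normSq (z : ℂ) : (log z).re = Real.log (normSq z) / 2 := by
  rw [log_re, ← Complex.sq_norm, Real.log_pow]
  push_cast
  ring

/-- the sum `Σᵢ (-1)ⁱ (pᵢ Log(1-xᵢ) + qᵢ Log xᵢ)` vanishes for every tuple in `FT⁺`
iff the five relations on the `pᵢ, qᵢ` hold. -/
theorem stmt3 (p q : Fin 5 → ℤ) :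
    (∀ v ∈ FTplus, ∑ i : Fin 5, (-1 : ℂ) ^ (i : ℕ) *
        (p i * Complex.log (1 - v i) + q i * Complex.log (v i)) = 0) ↔
    (p 2 = p 1 - p 0 ∧ p 3 = p 1 - p 0 + q 1 - q 0 ∧ q 3 = q 2 - q 1 ∧
      p 4 = q 1 - q 0 ∧ q 4 = q 2 - q 1 - p 0) := by
  constructor
  · intro h
    have hv := ftTuple_mem_FTplus
    have hs := congrArg re ((sum_ftTuple p q hv.2).symm.trans (h _ hv))
    have he : (log (1 - (3 + 8 * I) / (2 + 5 * I))).re =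
        (Real.log 10 - Real.log 29) / 2 := by
      have hx : (2 + 5 * I : ℂ) ≠ 0 := fun h => by simpa using congrArg im h
      rw [one_sub_div hx, log_re_eq_half_log_normSq, normSq_div, Real.log_div]
      all_goals norm_num [normSq_apply]
    simp only [add_re, ← ofReal_intCast, re_ofReal_mul, he, log_re_eq_half_log_normSq, zero_re] at hs
    have n0 : normSq (2 + 5 * I) = 29 := by norm_num [normSq_apply]
    have n1 : normSq (3 + 8 * I) = 73 := by norm_num [normSq_apply]
    have n2 : normSq (1 - (2 + 5 * I)) = 26 := by norm_num [normSq_apply]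
    have n3 : normSq (1 - (3 + 8 * I)) = 68 := by norm_num [normSq_apply]
    rw [n0, n1, n2, n3] at hs
    obtain ⟨hA, hB, hC, hD, hE⟩ := eq_zero_of_log_combination_eq_zero
      (A := q 0 - q 2 + q 3 + p 4 - (p 2 - p 3 + p 4)) (B := q 2 - q 1 - q 3)
      (C := p 0 - q 3 + q 4) (D := p 3 + q 3 - p 1 - p 4 - q 4) (E := p 2 - p 3 + p 4) (by
        push_cast at hs ⊢
        linear_combination 2 * hs)
    omega
  · rintro ⟨hp2, hp3, hq3, hp4, hq4⟩ v ⟨⟨x, y, -, -, -, rfl⟩, hv⟩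
    rw [sum_ftTuple p q hv, hp2, hp3, hq3, hp4, hq4]
    push_cast
    ring

end ExtendedBloch

end
end
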